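/- arXiv:1709.04355 — 3 statements merged into one kernel-verified Lean document; each statement's English description precedes it below -/
import Mathlib

section
/- Let 𝔻̄ be the closed unit disk in ℝ², let c ∈ ℝ and let γ ∈ ℝ with γ² < 2. There exists a constant C' > 0, depending only on c and γ, such that for every continuous centered Gaussian field Γ on 𝔻̄ whose covariance kernel C satisfies C(z,w) ≤ −log|z−w| + c for all z ≠ w in 𝔻̄, and every measurable f : 𝔻̄ → ℝ with |f| ≤ 1, the derivative in γ of the approximate chaos, D^γ(Γ, f) := ∫_{𝔻̄} f(z) (Γ(z) − γ C(z,z)) e^{γΓ(z) − (γ²/2)C(z,z)} dz, satisfies E[D^γ(Γ, f)²] ≤ C'. -/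
open MeasureTheory ProbabilityTheory Real

/-- A continuous centered Gaussian field on a set `K ⊂ ℝ²` (modelled by
`EuclideanSpace ℝ (Fin 2)`), with covariance kernel `C`. -/
def IsContGaussianField {Ω : Type*} [MeasureSpace Ω]
    (K : Set (EuclideanSpace ℝ (Fin 2)))
    (Γ : Ω → EuclideanSpace ℝ (Fin 2) → ℝ)
    (C : EuclideanSpace ℝ (Fin 2) → EuclideanSpace ℝ (Fin 2) → ℝ) : Prop :=
  Measurable (Function.uncurry Γ) ∧
  (∀ᵐ ω ∂(ℙ : Measure Ω), ContinuousOn (Γ ω) K) ∧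
  (∀ (n : ℕ) (a : Fin n → ℝ) (z : Fin n → EuclideanSpace ℝ (Fin 2)), (∀ j, z j ∈ K) →
    ∃ v : NNReal,
      Measure.map (fun ω => ∑ j, a j * Γ ω (z j)) (ℙ : Measure Ω) = gaussianReal 0 v) ∧
  (∀ z ∈ K, ∀ w ∈ K, C z w = ∫ ω, Γ ω z * Γ ω w) ∧
  ContinuousOn (fun p : EuclideanSpace ℝ (Fin 2) × EuclideanSpace ℝ (Fin 2) => C p.1 p.2)
    (K ×ˢ K)

/-- The derivative in `γ` of the approximate GMC integral:
`D^γ(Γ, f) = ∫ f(z) (Γ(z) − γ C(z,z)) exp(γ Γ(z) − (γ²/2) C(z,z)) dz`,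
for a sample path `g = Γ(ω, ·)`. -/
noncomputable def gmcDeriv (K : Set (EuclideanSpace ℝ (Fin 2))) (γ : ℝ)
    (C : EuclideanSpace ℝ (Fin 2) → EuclideanSpace ℝ (Fin 2) → ℝ)
    (g : EuclideanSpace ℝ (Fin 2) → ℝ) (f : EuclideanSpace ℝ (Fin 2) → ℝ) : ℝ :=
  ∫ z in K, f z * (g z - γ * C z z) * Real.exp (γ * g z - γ ^ 2 / 2 * C z z)

section GaussianMoments

variable {Ω : Type*} {mΩ : MeasurableSpace Ω} {μ : Measure Ω} {X Y : Ω → ℝ}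

/-- The second moment of a Gaussian variable about an arbitrary point. -/
lemma integral_sub_sq_of_map_eq_gaussianReal {U : Ω → ℝ} {m : ℝ} {v : NNReal}
    (hU : μ.map U = gaussianReal m v) (k : ℝ) :
    Integrable (fun ω => (U ω - k) ^ 2) μ ∧ ∫ ω, (U ω - k) ^ 2 ∂μ = v + (m - k) ^ 2 := by
  have hUm : AEMeasurable U μ := aemeasurable_of_map_neZero (by rw [hU]; infer_instance)
  have h2 : MemLp (fun x : ℝ => x) 2 (gaussianReal m v) := memLp_id_gaussianReal 2
  have hi : Integrable (fun x : ℝ => x) (gaussianReal m v) := h2.integrable (by norm_num)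
  have hsq : Integrable (fun x : ℝ => (x - k) ^ 2) (gaussianReal m v) :=
    (h2.sub (memLp_const k)).integrable_sq
  have hvar : ∫ x, (x - m) ^ 2 ∂gaussianReal m v = v := by
    have := variance_fun_id_gaussianReal (μ := m) (v := v)
    rwa [variance_eq_integral measurable_id'.aemeasurable, integral_id_gaussianReal] at this
  constructor
  · rw [← hU] at hsq
    exact hsq.comp_aemeasurable hUm
  · have hmap : ∫ ω, (U ω - k) ^ 2 ∂μ = ∫ x, (x - k) ^ 2 ∂gaussianReal m v := by
      rw [← hU, integral_map hUm (by fun_prop)]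
    have hexp : ∀ x : ℝ, (x - k) ^ 2 = (x - m) ^ 2 + (2 * (m - k) * x + ((m - k) ^ 2
        - 2 * (m - k) * m)) := fun x => by ring
    have hsq' : Integrable (fun x : ℝ => (x - m) ^ 2) (gaussianReal m v) :=
      (h2.sub (memLp_const m)).integrable_sq
    rw [hmap, integral_congr_ae (ae_of_all _ hexp),
      integral_add hsq' ((hi.const_mul _).fun_add (integrable_const _)),
      integral_add (hi.const_mul _) (integrable_const _), integral_const_mul, hvar,
      integral_id_gaussianReal]
    simp

/-- Each linear combination of a centered Gaussian pair has the variance predicted by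
bilinearity. -/
lemma map_linearCombination_eq_gaussianReal
    (h : ∀ s t : ℝ, ∃ v : NNReal, μ.map (fun ω => s * X ω + t * Y ω) = gaussianReal 0 v)
    (s t : ℝ) :
    ∃ v : NNReal, (v : ℝ) = s ^ 2 * ∫ ω, X ω * X ω ∂μ + 2 * s * t * ∫ ω, X ω * Y ω ∂μ
        + t ^ 2 * ∫ ω, Y ω * Y ω ∂μ ∧
      μ.map (fun ω => s * X ω + t * Y ω) = gaussianReal 0 v := by
  obtain ⟨v, hv⟩ := h s t
  refine ⟨v, ?_, hv⟩
  have hL : ∀ s t : ℝ, MemLp (fun ω => s * X ω + t * Y ω) 2 μ := by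
    intro s t
    obtain ⟨v, hv⟩ := h s t
    have hm : AEMeasurable (fun ω => s * X ω + t * Y ω) μ :=
      aemeasurable_of_map_neZero (by rw [hv]; infer_instance)
    have := memLp_id_gaussianReal (μ := 0) (v := v) 2
    rw [← hv] at this
    exact this.comp_of_map hm
  have hX : MemLp X 2 μ := by simpa using hL 1 0
  have hY : MemLp Y 2 μ := by simpa using hL 0 1
  have hXX : Integrable (fun ω => X ω * X ω) μ := hX.integrable_mul hX
  have hXY : Integrable (fun ω => X ω * Y ω) μ := hX.integrable_mul hY
  have hYY : Integrable (fun ω => Y ω * Y ω) μ := hY.integrable_mul hY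
  have h1 := (integral_sub_sq_of_map_eq_gaussianReal hv 0).2
  have hexp : ∀ ω, (s * X ω + t * Y ω - 0) ^ 2 = s ^ 2 * (X ω * X ω)
      + 2 * s * t * (X ω * Y ω) + t ^ 2 * (Y ω * Y ω) := fun ω => by ring
  simp_rw [hexp] at h1
  rw [integral_add ((hXX.const_mul _).fun_add (hXY.const_mul _)) (hYY.const_mul _),
    integral_add (hXX.const_mul _) (hXY.const_mul _), integral_const_mul, integral_const_mul,
    integral_const_mul] at h1
  simpa using h1.symm

variable [IsProbabilityMeasure μ]

/-- A random variable with the moment-generating function of a Gaussian is Gaussian. -/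
lemma map_eq_gaussianReal_of_mgf {U : Ω → ℝ} (hU : AEMeasurable U μ) {m : ℝ} {v : NNReal}
    (h : ∀ t, mgf U μ t = exp (m * t + v * t ^ 2 / 2)) : μ.map U = gaussianReal m v := by
  have hmgf : mgf id (gaussianReal m v) = mgf U μ := by
    rw [mgf_id_gaussianReal]
    exact (funext h).symm
  have heq := eqOn_complexMGF_of_mgf hmgf
  have := Measure.ext_of_complexMGF_eq aemeasurable_id hU
    (funext fun z => heq (by simp))
  simpa using this.symm

/-- Exponential tilting by `γ (X + Y)` shifts the mean of a centered Gaussian pair by its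
covariance with `γ (X + Y)`. -/
lemma map_tilted_linearCombination_eq_gaussianReal
    (h : ∀ s t : ℝ, ∃ v : NNReal, μ.map (fun ω => s * X ω + t * Y ω) = gaussianReal 0 v)
    (γ s t : ℝ) :
    ∃ v : NNReal, (v : ℝ) = s ^ 2 * ∫ ω, X ω * X ω ∂μ + 2 * s * t * ∫ ω, X ω * Y ω ∂μ
        + t ^ 2 * ∫ ω, Y ω * Y ω ∂μ ∧
      (μ.tilted (fun ω => γ * X ω + γ * Y ω)).map (fun ω => s * X ω + t * Y ω)
        = gaussianReal (γ * (s * (∫ ω, X ω * X ω ∂μ + ∫ ω, X ω * Y ω ∂μ)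
          + t * (∫ ω, Y ω * Y ω ∂μ + ∫ ω, X ω * Y ω ∂μ))) v := by
  obtain ⟨v, hv, hmap⟩ := map_linearCombination_eq_gaussianReal h s t
  refine ⟨v, hv, ?_⟩
  have hm : ∀ s t : ℝ, AEMeasurable (fun ω => s * X ω + t * Y ω) μ := by
    intro s t
    obtain ⟨v, hv⟩ := h s t
    exact aemeasurable_of_map_neZero (by rw [hv]; infer_instance)
  have hmgf : ∀ s t : ℝ, Integrable (fun ω => exp (s * X ω + t * Y ω)) μ ∧
      ∫ ω, exp (s * X ω + t * Y ω) ∂μ = exp ((s ^ 2 * ∫ ω, X ω * X ω ∂μ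
        + 2 * s * t * ∫ ω, X ω * Y ω ∂μ + t ^ 2 * ∫ ω, Y ω * Y ω ∂μ) / 2) := by
    intro s t
    obtain ⟨v, hv, hmap⟩ := map_linearCombination_eq_gaussianReal h s t
    have h1 := mgf_gaussianReal hmap 1
    have h2 := integrable_exp_mul_gaussianReal (μ := 0) (v := v) 1
    rw [← hmap] at h2
    have h3 := h2.comp_aemeasurable (hm s t)
    simp only [mgf, one_mul, Function.comp_def, zero_add, one_pow, mul_one] at h1 h3
    exact ⟨h3, by rw [h1, hv]⟩
  have hprob : IsProbabilityMeasure (μ.tilted (fun ω => γ * X ω + γ * Y ω)) :=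
    isProbabilityMeasure_tilted (hmgf γ γ).1
  have hmt : AEMeasurable (fun ω => s * X ω + t * Y ω)
      (μ.tilted (fun ω => γ * X ω + γ * Y ω)) :=
    (hm s t).mono_ac (tilted_absolutelyContinuous _ _)
  refine map_eq_gaussianReal_of_mgf hmt fun r => ?_
  have hsum : ∀ ω, ((fun ω => γ * X ω + γ * Y ω) + fun ω => r * (s * X ω + t * Y ω)) ω
      = (γ + r * s) * X ω + (γ + r * t) * Y ω := fun ω => by
    simp only [Pi.add_apply]
    ring
  rw [mgf, integral_exp_tilted]
  simp_rw [hsum]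
  rw [(hmgf _ _).2, (hmgf _ _).2, ← exp_sub, hv]
  congr 1
  ring

/-- The two-point function of the `γ`-derivative of a Gaussian exponential. -/
lemma integral_gaussian_deriv_exp_mul
    (h : ∀ s t : ℝ, ∃ v : NNReal, μ.map (fun ω => s * X ω + t * Y ω) = gaussianReal 0 v)
    (γ : ℝ) {a b c : ℝ} (ha : a = ∫ ω, X ω * X ω ∂μ) (hb : b = ∫ ω, Y ω * Y ω ∂μ)
    (hc : c = ∫ ω, X ω * Y ω ∂μ) :
    Integrable (fun ω => ((X ω - γ * a) * exp (γ * X ω - γ ^ 2 / 2 * a)) *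
      ((Y ω - γ * b) * exp (γ * Y ω - γ ^ 2 / 2 * b))) μ ∧
    ∫ ω, ((X ω - γ * a) * exp (γ * X ω - γ ^ 2 / 2 * a)) *
      ((Y ω - γ * b) * exp (γ * Y ω - γ ^ 2 / 2 * b)) ∂μ
      = (c + γ ^ 2 * c ^ 2) * exp (γ ^ 2 * c) := by
  set Q := μ.tilted (fun ω => γ * X ω + γ * Y ω) with hQ
  obtain ⟨v₀, hv₀, hmap₀⟩ := map_linearCombination_eq_gaussianReal h γ γ
  have hm₀ : AEMeasurable (fun ω => γ * X ω + γ * Y ω) μ :=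
    aemeasurable_of_map_neZero (by rw [hmap₀]; infer_instance)
  have hi : Integrable (fun ω => exp (γ * X ω + γ * Y ω)) μ := by
    have h2 := integrable_exp_mul_gaussianReal (μ := 0) (v := v₀) 1
    rw [← hmap₀] at h2
    simpa [Function.comp_def] using h2.comp_aemeasurable hm₀
  have hZ : ∫ ω, exp (γ * X ω + γ * Y ω) ∂μ = exp (γ ^ 2 * (a + 2 * c + b) / 2) := by
    have h1 := mgf_gaussianReal hmap₀ 1
    simp only [mgf, one_mul, zero_add, one_pow, mul_one] at h1
    rw [h1, hv₀, ← ha, ← hb, ← hc]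
    congr 1
    ring
  obtain ⟨v₁, hv₁, hmap₁⟩ := map_tilted_linearCombination_eq_gaussianReal h γ 1 1
  obtain ⟨v₂, hv₂, hmap₂⟩ := map_tilted_linearCombination_eq_gaussianReal h γ 1 (-1)
  rw [← ha, ← hb, ← hc] at hv₁ hv₂ hmap₁ hmap₂
  obtain ⟨hi₁, he₁⟩ := integral_sub_sq_of_map_eq_gaussianReal hmap₁ (γ * a + γ * b)
  obtain ⟨hi₂, he₂⟩ := integral_sub_sq_of_map_eq_gaussianReal hmap₂ (γ * a - γ * b)
  have hpol : ∀ ω, (X ω - γ * a) * (Y ω - γ * b)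
      = 1 / 4 * (((1 * X ω + 1 * Y ω) - (γ * a + γ * b)) ^ 2
        - ((1 * X ω + -1 * Y ω) - (γ * a - γ * b)) ^ 2) := fun ω => by ring
  have hiQ : Integrable (fun ω => (X ω - γ * a) * (Y ω - γ * b)) Q := by
    simp_rw [hpol]
    exact (hi₁.sub hi₂).const_mul _
  have heQ : ∫ ω, (X ω - γ * a) * (Y ω - γ * b) ∂Q = c + γ ^ 2 * c ^ 2 := by
    simp_rw [hpol]
    rw [integral_const_mul, integral_sub hi₁ hi₂, he₁, he₂, hv₁, hv₂]
    ring
  have hfac : ∀ ω, ((X ω - γ * a) * exp (γ * X ω - γ ^ 2 / 2 * a)) *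
      ((Y ω - γ * b) * exp (γ * Y ω - γ ^ 2 / 2 * b))
      = exp (-(γ ^ 2 * (a + b) / 2)) *
        (exp (γ * X ω + γ * Y ω) * ((X ω - γ * a) * (Y ω - γ * b))) := fun ω => by
    have : exp (γ * X ω - γ ^ 2 / 2 * a) * exp (γ * Y ω - γ ^ 2 / 2 * b)
        = exp (-(γ ^ 2 * (a + b) / 2)) * exp (γ * X ω + γ * Y ω) := by
      rw [← exp_add, ← exp_add]
      congr 1
      ring
    linear_combination (X ω - γ * a) * (Y ω - γ * b) * this
  simp_rw [hfac]
  have hiμ := (integrable_tilted_iff hi _).1 hiQ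
  simp only [smul_eq_mul] at hiμ
  refine ⟨hiμ.const_mul _, ?_⟩
  rw [integral_const_mul]
  rw [hQ, integral_tilted, hZ] at heQ
  simp_rw [smul_eq_mul, div_mul_eq_mul_div] at heQ
  rw [integral_div, div_eq_iff (exp_pos _).ne'] at heQ
  rw [heQ, mul_left_comm, ← exp_add]
  congr 2
  ring

end GaussianMoments

section Bounds

/-- The two-point function `(x + γ² x²) exp (γ² x)` is bounded from above by a multiple of
`exp (s x)` for any `s > γ²`, up to an additive constant. -/
lemma add_sq_mul_exp_le {γ δ x L : ℝ} (hδ : 0 < δ) (hxL : x ≤ L) :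
    (x + γ ^ 2 * x ^ 2) * exp (γ ^ 2 * x)
      ≤ (1 / δ + 2 * γ ^ 2 / δ ^ 2) * exp ((γ ^ 2 + δ) * L) + 2 * (γ ^ 2)⁻¹ := by
  rcases le_or_gt 0 x with hx | hx
  · have hq := quadratic_le_exp_of_nonneg (mul_nonneg hδ.le hx)
    have h1 : x ≤ 1 / δ * exp (δ * x) := by
      rw [one_div, inv_mul_eq_div, le_div_iff₀ hδ]
      nlinarith [sq_nonneg (δ * x)]
    have h2 : x ^ 2 ≤ 2 / δ ^ 2 * exp (δ * x) := by
      rw [div_mul_eq_mul_div, le_div_iff₀ (by positivity)]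
      nlinarith [mul_nonneg hδ.le hx]
    have h3 : x + γ ^ 2 * x ^ 2 ≤ (1 / δ + 2 * γ ^ 2 / δ ^ 2) * exp (δ * x) := by
      have := mul_le_mul_of_nonneg_left h2 (sq_nonneg γ)
      calc x + γ ^ 2 * x ^ 2 ≤ 1 / δ * exp (δ * x) + γ ^ 2 * (2 / δ ^ 2 * exp (δ * x)) :=
            add_le_add h1 this
        _ = _ := by ring
    calc (x + γ ^ 2 * x ^ 2) * exp (γ ^ 2 * x)
        ≤ (1 / δ + 2 * γ ^ 2 / δ ^ 2) * exp (δ * x) * exp (γ ^ 2 * x) :=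
          mul_le_mul_of_nonneg_right h3 (exp_pos _).le
      _ = (1 / δ + 2 * γ ^ 2 / δ ^ 2) * exp ((γ ^ 2 + δ) * x) := by
          rw [mul_assoc, ← exp_add]
          congr 2
          ring
      _ ≤ (1 / δ + 2 * γ ^ 2 / δ ^ 2) * exp ((γ ^ 2 + δ) * L) := by gcongr
      _ ≤ _ := le_add_of_nonneg_right (by positivity)
  · have h0 : (0 : ℝ) ≤ (1 / δ + 2 * γ ^ 2 / δ ^ 2) * exp ((γ ^ 2 + δ) * L) := by positivity
    have h1 : (x + γ ^ 2 * x ^ 2) * exp (γ ^ 2 * x) ≤ 2 * (γ ^ 2)⁻¹ := by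
      rcases eq_or_ne γ 0 with rfl | hγ
      · simpa using hx.le
      · have hγ2 : 0 < γ ^ 2 := by positivity
        have hq := quadratic_le_exp_of_nonneg
          (show 0 ≤ γ ^ 2 * -x from mul_nonneg hγ2.le (by linarith))
        have he : exp (γ ^ 2 * -x) * exp (γ ^ 2 * x) = 1 := by
          rw [← exp_add]
          simp
        rw [← div_eq_mul_inv, le_div_iff₀ hγ2]
        have hp := exp_pos (γ ^ 2 * x)
        have h2 : (γ ^ 2 * x) ^ 2 ≤ 2 * exp (γ ^ 2 * -x) := by nlinarith
        have h3 : (γ ^ 2 * x) ^ 2 * exp (γ ^ 2 * x) ≤ 2 := by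
          calc _ ≤ 2 * exp (γ ^ 2 * -x) * exp (γ ^ 2 * x) :=
                mul_le_mul_of_nonneg_right h2 hp.le
            _ = 2 := by rw [mul_assoc, he, mul_one]
        have h4 : x * γ ^ 2 * exp (γ ^ 2 * x) ≤ 0 :=
          mul_nonpos_of_nonpos_of_nonneg (mul_nonpos_of_nonpos_of_nonneg hx.le hγ2.le) hp.le
        nlinarith
    linarith

/-- An integrable, translation-invariant majorant for the two-point function of the
`γ`-derivative of the approximate chaos on the closed unit disk. -/
lemma exists_integrable_majorant (c γ : ℝ) (hγ : γ ^ 2 < 2) :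
    ∃ g : EuclideanSpace ℝ (Fin 2) → ℝ, Integrable g ∧ (∀ u, 0 ≤ g u) ∧
      ∀ z ∈ Metric.closedBall (0 : EuclideanSpace ℝ (Fin 2)) 1,
      ∀ w ∈ Metric.closedBall (0 : EuclideanSpace ℝ (Fin 2)) 1, z ≠ w →
      ∀ x ≤ -log (dist z w) + c, (x + γ ^ 2 * x ^ 2) * exp (γ ^ 2 * x) ≤ g (z - w) := by
  set δ := (2 - γ ^ 2) / 2 with hδ_def
  have hδ : 0 < δ := by linarith
  set s := γ ^ 2 + δ with hs
  set A := (1 / δ + 2 * γ ^ 2 / δ ^ 2) * exp (s * c) with hA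
  have hA0 : 0 ≤ A := by positivity
  refine ⟨(Metric.ball 0 3).indicator fun u => A * ‖u‖ ^ (-s) + 2 * (γ ^ 2)⁻¹, ?_, ?_, ?_⟩
  · rw [integrable_indicator_iff Metric.isOpen_ball.measurableSet]
    refine Integrable.add ?_ (integrableOn_const (by finiteness))
    refine integrableOn_ball_of_norm_le_rpow (C := A) (α := s) (by simp) (by simp; linarith)
      (ae_of_all _ fun u => ?_) ?_
    · rw [norm_of_nonneg (by positivity)]
    · exact (Measurable.aestronglyMeasurable (by fun_prop))
  · exact fun u => Set.indicator_nonneg (fun u _ => by positivity) u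
  · intro z hz w hw hzw x hx
    have hmem : z - w ∈ Metric.ball (0 : EuclideanSpace ℝ (Fin 2)) 3 := by
      rw [mem_ball_zero_iff]
      have := norm_sub_le z w
      rw [mem_closedBall_zero_iff] at hz hw
      linarith
    rw [Set.indicator_of_mem hmem]
    refine (add_sq_mul_exp_le hδ hx).trans_eq ?_
    have hd : 0 < ‖z - w‖ := norm_pos_iff.2 (sub_ne_zero.2 hzw)
    rw [dist_eq_norm, rpow_def_of_pos hd, hA, mul_assoc, ← exp_add]
    congr 3
    ring

variable {α : Type*} {mα : MeasurableSpace α} {ν : Measure α}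

/-- A bound for a Bochner integral by that of an integrable majorant with nonnegative integral,
with no integrability assumption on the smaller function. -/
lemma integral_le_of_ae_le {f g : α → ℝ} (hg : Integrable g ν) (hg0 : 0 ≤ ∫ x, g x ∂ν)
    (hfg : f ≤ᵐ[ν] g) : ∫ x, f x ∂ν ≤ ∫ x, g x ∂ν := by
  by_cases hf : Integrable f ν
  · exact integral_mono_ae hf hg hfg
  · rwa [integral_undef hf]

variable {Ω : Type*} {mΩ : MeasurableSpace Ω} {μ : Measure Ω}
  [IsFiniteMeasure μ] [IsFiniteMeasure ν]

/-- A random function with bounded second moments is square integrable for the product measure. -/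
lemma integrable_sq_prod {F : Ω → α → ℝ} (hF : Measurable (Function.uncurry F)) {M : ℝ}
    (hM : ∀ᵐ z ∂ν, Integrable (fun ω => F ω z ^ 2) μ ∧ ∫ ω, F ω z ^ 2 ∂μ ≤ M) :
    Integrable (fun p : Ω × α => F p.1 p.2 ^ 2) (μ.prod ν) := by
  have hm : AEStronglyMeasurable (fun p : Ω × α => F p.1 p.2 ^ 2) (μ.prod ν) :=
    (hF.pow_const 2).aestronglyMeasurable
  rw [integrable_prod_iff' hm]
  refine ⟨hM.mono fun z hz => hz.1, ?_⟩
  refine Integrable.of_bound (C := M) hm.norm.prod_swap.integral_prod_right' ?_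
  filter_upwards [hM] with z hz
  rw [norm_of_nonneg (integral_nonneg fun _ => norm_nonneg _)]
  simpa using hz.2

/-- A random function with bounded second moments is integrable for the product measure. -/
lemma integrable_prod_of_second_moment {F : Ω → α → ℝ} (hF : Measurable (Function.uncurry F))
    {M : ℝ} (hM : ∀ᵐ z ∂ν, Integrable (fun ω => F ω z ^ 2) μ ∧ ∫ ω, F ω z ^ 2 ∂μ ≤ M) :
    Integrable (fun p : Ω × α => F p.1 p.2) (μ.prod ν) :=
  ((memLp_two_iff_integrable_sq hF.aestronglyMeasurable).2
    (integrable_sq_prod hF hM)).integrable (by norm_num)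

/-- The second moment of the integral of a random function is the double integral of its
two-point function. -/
lemma lintegral_sq_integral_eq {F : Ω → α → ℝ} (hF : Measurable (Function.uncurry F))
    {M : ℝ} (hM : ∀ᵐ z ∂ν, Integrable (fun ω => F ω z ^ 2) μ ∧ ∫ ω, F ω z ^ 2 ∂μ ≤ M) :
    ∫⁻ ω, ENNReal.ofReal ((∫ z, F ω z ∂ν) ^ 2) ∂μ
      = ENNReal.ofReal (∫ z, ∫ w, ∫ ω, F ω z * F ω w ∂μ ∂ν ∂ν) := by
  have hsq := integrable_sq_prod hF hM
  have hz : Integrable (fun p : Ω × α × α => F p.1 p.2.1 ^ 2) (μ.prod (ν.prod ν)) :=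
    (measurePreserving_prodAssoc μ ν ν).symm.integrable_comp_of_integrable
      (hsq.comp_fst ν)
  have hw : Integrable (fun p : Ω × α × α => F p.1 p.2.2 ^ 2) (μ.prod (ν.prod ν)) :=
    ((MeasurePreserving.id μ).prod
      (Measure.measurePreserving_swap (μ := ν) (ν := ν))).integrable_comp_of_integrable hz
  have hint : Integrable (fun p : Ω × α × α => F p.1 p.2.1 * F p.1 p.2.2)
      (μ.prod (ν.prod ν)) := by
    refine (hz.add hw).mono' ?_ (ae_of_all _ fun p => ?_)
    · have h1 : Measurable (fun p : Ω × α × α => F p.1 p.2.1) :=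
        hF.comp (measurable_fst.prodMk measurable_snd.fst)
      have h2 : Measurable (fun p : Ω × α × α => F p.1 p.2.2) :=
        hF.comp (measurable_fst.prodMk measurable_snd.snd)
      exact (h1.mul h2).aestronglyMeasurable
    · rw [norm_mul, Pi.add_apply, norm_eq_abs, norm_eq_abs]
      nlinarith [sq_nonneg (|F p.1 p.2.1| - |F p.1 p.2.2|), sq_abs (F p.1 p.2.1),
        sq_abs (F p.1 p.2.2), sq_nonneg (F p.1 p.2.1), sq_nonneg (F p.1 p.2.2)]
  have hD : ∀ ω, (∫ z, F ω z ∂ν) ^ 2 = ∫ q : α × α, F ω q.1 * F ω q.2 ∂ν.prod ν := fun ω => by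
    rw [integral_prod_mul, sq]
  simp_rw [hD]
  rw [← ofReal_integral_eq_lintegral_ofReal hint.integral_prod_left
    (ae_of_all _ fun ω => (sq_nonneg _).trans_eq (hD ω)),
    integral_integral_swap hint, integral_prod _ hint.integral_prod_right]

end Bounds

section Field

variable {Ω : Type*} {K : Set (EuclideanSpace ℝ (Fin 2))} {Γ : Ω → EuclideanSpace ℝ (Fin 2) → ℝ}
  {C : EuclideanSpace ℝ (Fin 2) → EuclideanSpace ℝ (Fin 2) → ℝ}

/-- The integrand of `gmcDeriv`, with the variance cut off outside `K`. -/
noncomputable def gmcDerivIntegrand (K : Set (EuclideanSpace ℝ (Fin 2))) (γ : ℝ)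
    (C : EuclideanSpace ℝ (Fin 2) → EuclideanSpace ℝ (Fin 2) → ℝ)
    (Γ : Ω → EuclideanSpace ℝ (Fin 2) → ℝ) (f : EuclideanSpace ℝ (Fin 2) → ℝ)
    (ω : Ω) (z : EuclideanSpace ℝ (Fin 2)) : ℝ :=
  f z * ((Γ ω z - γ * K.indicator (fun z => C z z) z) *
    exp (γ * Γ ω z - γ ^ 2 / 2 * K.indicator (fun z => C z z) z))

lemma gmcDeriv_eq_setIntegral (hK : MeasurableSet K) (γ : ℝ)
    (f : EuclideanSpace ℝ (Fin 2) → ℝ) (ω : Ω) :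
    gmcDeriv K γ C (Γ ω) f = ∫ z in K, gmcDerivIntegrand K γ C Γ f ω z := by
  refine setIntegral_congr_fun hK fun z hz => ?_
  simp only [gmcDerivIntegrand, Set.indicator_of_mem hz, mul_assoc]

variable [MeasureSpace Ω]

lemma IsContGaussianField.continuousOn_variance (h : IsContGaussianField K Γ C) :
    ContinuousOn (fun z => C z z) K :=
  h.2.2.2.2.comp (f := fun z => (z, z)) (by fun_prop) fun _ hz => ⟨hz, hz⟩

lemma IsContGaussianField.measurable_gmcDerivIntegrand (h : IsContGaussianField K Γ C)
    (hK : MeasurableSet K) (γ : ℝ) {f : EuclideanSpace ℝ (Fin 2) → ℝ} (hf : Measurable f) :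
    Measurable (Function.uncurry (gmcDerivIntegrand K γ C Γ f)) := by
  have hd : Measurable (K.indicator fun z => C z z) := by
    classical
    rw [← Set.piecewise_eq_indicator]
    exact h.continuousOn_variance.measurable_piecewise continuousOn_const hK
  have hd2 := hd.comp (measurable_snd : Measurable (Prod.snd : Ω × _ → _))
  have hf2 := hf.comp (measurable_snd : Measurable (Prod.snd : Ω × _ → _))
  have hΓ := h.1
  exact hf2.mul ((hΓ.sub (hd2.const_mul γ)).mul
    ((hΓ.const_mul γ).sub (hd2.const_mul (γ ^ 2 / 2))).exp)

variable [IsProbabilityMeasure (ℙ : Measure Ω)]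

/-- The two-point function of the integrand of `gmcDeriv`. -/
lemma IsContGaussianField.integral_gmcDerivIntegrand_mul (h : IsContGaussianField K Γ C)
    (γ : ℝ) (f : EuclideanSpace ℝ (Fin 2) → ℝ) {z w : EuclideanSpace ℝ (Fin 2)}
    (hz : z ∈ K) (hw : w ∈ K) :
    Integrable (fun ω => gmcDerivIntegrand K γ C Γ f ω z * gmcDerivIntegrand K γ C Γ f ω w) ∧
    ∫ ω, gmcDerivIntegrand K γ C Γ f ω z * gmcDerivIntegrand K γ C Γ f ω w
      = f z * f w * ((C z w + γ ^ 2 * C z w ^ 2) * exp (γ ^ 2 * C z w)) := by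
  obtain ⟨-, -, hG, hC, -⟩ := h
  have hlin : ∀ s t : ℝ, ∃ v : NNReal,
      (ℙ : Measure Ω).map (fun ω => s * Γ ω z + t * Γ ω w) = gaussianReal 0 v := fun s t => by
    simpa using hG 2 ![s, t] ![z, w] (by simp [Fin.forall_fin_two, hz, hw])
  obtain ⟨hi, he⟩ := integral_gaussian_deriv_exp_mul hlin γ (hC z hz z hz) (hC w hw w hw)
    (hC z hz w hw)
  have hfac : ∀ ω, gmcDerivIntegrand K γ C Γ f ω z * gmcDerivIntegrand K γ C Γ f ω w
      = f z * f w * (((Γ ω z - γ * C z z) * exp (γ * Γ ω z - γ ^ 2 / 2 * C z z)) *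
        ((Γ ω w - γ * C w w) * exp (γ * Γ ω w - γ ^ 2 / 2 * C w w))) := fun ω => by
    simp only [gmcDerivIntegrand, Set.indicator_of_mem hz, Set.indicator_of_mem hw]
    ring
  simp_rw [hfac]
  exact ⟨hi.const_mul _, by rw [integral_const_mul, he]⟩

lemma IsContGaussianField.exists_second_moment_bound (h : IsContGaussianField K Γ C)
    (hK : IsCompact K) (γ : ℝ) {f : EuclideanSpace ℝ (Fin 2) → ℝ} (hf : ∀ z, |f z| ≤ 1) :
    ∃ M : ℝ, ∀ᵐ z ∂volume.restrict K, Integrable (fun ω => gmcDerivIntegrand K γ C Γ f ω z ^ 2) ∧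
      ∫ ω, gmcDerivIntegrand K γ C Γ f ω z ^ 2 ≤ M := by
  have hdiag := h.continuousOn_variance
  have hcont : ContinuousOn
      (fun z => (C z z + γ ^ 2 * C z z ^ 2) * exp (γ ^ 2 * C z z)) K :=
    (hdiag.add ((hdiag.pow 2).const_mul _)).mul (hdiag.const_mul _).rexp
  obtain ⟨M, hM⟩ := hK.exists_bound_of_continuousOn hcont
  refine ⟨M, (ae_restrict_iff' hK.measurableSet).2 (ae_of_all _ fun z hz => ?_)⟩
  simp_rw [sq (gmcDerivIntegrand K γ C Γ f _ z)]
  obtain ⟨hi, he⟩ := h.integral_gmcDerivIntegrand_mul γ f hz hz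
  refine ⟨hi, he.trans_le ((le_abs_self _).trans ?_)⟩
  rw [abs_mul, abs_mul]
  have h1 := mul_le_one₀ (hf z) (abs_nonneg _) (hf z)
  exact (mul_le_of_le_one_left (abs_nonneg _) h1).trans (hM z hz)

/-- For a nonnegative weight, only the positive part of the two-point function contributes. -/
lemma IsContGaussianField.lintegral_sq_gmcDeriv_le (h : IsContGaussianField K Γ C)
    (hK : IsCompact K) (γ : ℝ) {g : EuclideanSpace ℝ (Fin 2) → ℝ} (hg : Integrable g)
    (hg0 : ∀ u, 0 ≤ g u)
    (hCg : ∀ z ∈ K, ∀ w ∈ K, z ≠ w →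
      (C z w + γ ^ 2 * C z w ^ 2) * exp (γ ^ 2 * C z w) ≤ g (z - w))
    {f : EuclideanSpace ℝ (Fin 2) → ℝ} (hf : Measurable f) (hf0 : ∀ z, 0 ≤ f z)
    (hf1 : ∀ z, f z ≤ 1) :
    ∫⁻ ω, ENNReal.ofReal (gmcDeriv K γ C (Γ ω) f ^ 2)
      ≤ ENNReal.ofReal (volume.real K * ∫ u, g u) := by
  have : IsFiniteMeasure (volume.restrict K) := ⟨by simpa using hK.measure_lt_top⟩
  obtain ⟨M, hM⟩ := h.exists_second_moment_bound hK γ (f := f)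
    fun z => by rw [abs_of_nonneg (hf0 z)]; exact hf1 z
  simp_rw [gmcDeriv_eq_setIntegral hK.measurableSet]
  rw [lintegral_sq_integral_eq (h.measurable_gmcDerivIntegrand hK.measurableSet γ hf) hM]
  refine ENNReal.ofReal_le_ofReal ?_
  have hB : 0 ≤ ∫ u, g u := integral_nonneg hg0
  have hinner : ∀ z ∈ K, ∫ w in K, ∫ ω, gmcDerivIntegrand K γ C Γ f ω z *
      gmcDerivIntegrand K γ C Γ f ω w ≤ ∫ u, g u := fun z hz => by
    have hgz : Integrable (fun w => g (z - w)) := hg.comp_sub_left z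
    calc _ ≤ ∫ w in K, g (z - w) := by
          refine integral_le_of_ae_le hgz.integrableOn (integral_nonneg fun _ => hg0 _) ?_
          have hne : ∀ᵐ w, w ≠ z := by simp [ae_iff]
          filter_upwards [ae_restrict_mem hK.measurableSet, ae_restrict_of_ae hne] with w hw hwz
          rw [(h.integral_gmcDerivIntegrand_mul γ f hz hw).2]
          have hfz := hf0 z
          have hfw := hf0 w
          calc _ ≤ f z * f w * g (z - w) := by
                gcongr
                exact hCg z hz w hw hwz.symm
            _ ≤ g (z - w) := mul_le_of_le_one_left (hg0 _) (mul_le_one₀ (hf1 z) hfw (hf1 w))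
      _ ≤ ∫ w, g (z - w) := setIntegral_le_integral hgz (ae_of_all _ fun _ => hg0 _)
      _ = ∫ u, g u := integral_sub_left_eq_self g volume z
  calc _ ≤ ∫ z in K, ∫ u, g u := by
        refine integral_le_of_ae_le (integrable_const _) (integral_nonneg fun _ => hB) ?_
        filter_upwards [ae_restrict_mem hK.measurableSet] with z hz using hinner z hz
    _ = _ := by simp

/-- Almost surely, `gmcDeriv` is additive in the weight. -/
lemma IsContGaussianField.gmcDeriv_sub (h : IsContGaussianField K Γ C)
    (hK : IsCompact K) (γ : ℝ) {f₁ f₂ : EuclideanSpace ℝ (Fin 2) → ℝ} (hf₁ : Measurable f₁)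
    (hf₂ : Measurable f₂) (hf₁' : ∀ z, |f₁ z| ≤ 1) (hf₂' : ∀ z, |f₂ z| ≤ 1) :
    ∀ᵐ ω, gmcDeriv K γ C (Γ ω) (fun z => f₁ z - f₂ z)
      = gmcDeriv K γ C (Γ ω) f₁ - gmcDeriv K γ C (Γ ω) f₂ := by
  have : IsFiniteMeasure (volume.restrict K) := ⟨by simpa using hK.measure_lt_top⟩
  have hint : ∀ f : EuclideanSpace ℝ (Fin 2) → ℝ, Measurable f → (∀ z, |f z| ≤ 1) →
      ∀ᵐ ω, IntegrableOn (gmcDerivIntegrand K γ C Γ f ω) K := fun f hf hf' => by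
    obtain ⟨M, hM⟩ := h.exists_second_moment_bound hK γ hf'
    exact (integrable_prod_of_second_moment
      (h.measurable_gmcDerivIntegrand hK.measurableSet γ hf) hM).prod_right_ae
  filter_upwards [hint f₁ hf₁ hf₁', hint f₂ hf₂ hf₂'] with ω h₁ h₂
  simp_rw [gmcDeriv_eq_setIntegral hK.measurableSet]
  rw [← integral_sub h₁ h₂]
  congr 1 with z
  simp only [gmcDerivIntegrand]
  ring

end Field

/-- **Uniform second moment bound for the `γ`-derivative of the approximate GMC.**
Let `𝔻̄` be the closed unit disk, `c ∈ ℝ` and `γ² < 2`. There is a constant `C' > 0`,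
depending only on `c` and `γ`, such that for every continuous centered Gaussian field `Γ` on
`𝔻̄` with covariance kernel `C(z,w) ≤ −log|z−w| + c` off the diagonal and every measurable
`f` with `|f| ≤ 1`, one has `E[D^γ(Γ,f)²] ≤ C'`. -/
theorem gmc_deriv_second_moment_bound (c γ : ℝ) (hγ : γ ^ 2 < 2) :
    ∃ C' > (0 : ℝ),
      ∀ (Ω : Type) (_ : MeasureSpace Ω), IsProbabilityMeasure (ℙ : Measure Ω) →
      ∀ (Γ : Ω → EuclideanSpace ℝ (Fin 2) → ℝ)
        (C : EuclideanSpace ℝ (Fin 2) → EuclideanSpace ℝ (Fin 2) → ℝ),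
        IsContGaussianField (Metric.closedBall (0 : EuclideanSpace ℝ (Fin 2)) 1) Γ C →
        (∀ z ∈ Metric.closedBall (0 : EuclideanSpace ℝ (Fin 2)) 1,
          ∀ w ∈ Metric.closedBall (0 : EuclideanSpace ℝ (Fin 2)) 1,
          z ≠ w → C z w ≤ -Real.log (dist z w) + c) →
        ∀ f : EuclideanSpace ℝ (Fin 2) → ℝ, Measurable f → (∀ z, |f z| ≤ 1) →
          (∫⁻ ω, ENNReal.ofReal
              ((gmcDeriv (Metric.closedBall (0 : EuclideanSpace ℝ (Fin 2)) 1) γ C (Γ ω) f) ^ 2))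
            ≤ ENNReal.ofReal C' := by
  obtain ⟨g, hg, hg0, hmaj⟩ := exists_integrable_majorant c γ hγ
  set K := Metric.closedBall (0 : EuclideanSpace ℝ (Fin 2)) 1
  have hK : IsCompact K := isCompact_closedBall _ _
  set A := volume.real K * ∫ u, g u
  have hA : 0 ≤ A := mul_nonneg measureReal_nonneg (integral_nonneg hg0)
  refine ⟨4 * A + 1, by linarith, fun Ω _ _ Γ C h hC f hf hf' => ?_⟩
  have hCg : ∀ z ∈ K, ∀ w ∈ K, z ≠ w →
      (C z w + γ ^ 2 * C z w ^ 2) * exp (γ ^ 2 * C z w) ≤ g (z - w) :=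
    fun z hz w hw hzw => hmaj z hz w hw hzw _ (hC z hz w hw hzw)
  have hp : Measurable fun z => max (f z) 0 := hf.max measurable_const
  have hn : Measurable fun z => max (-f z) 0 := hf.neg.max measurable_const
  have hp0 : ∀ z, 0 ≤ max (f z) 0 := fun z => le_max_right _ _
  have hn0 : ∀ z, 0 ≤ max (-f z) 0 := fun z => le_max_right _ _
  have hp1 : ∀ z, max (f z) 0 ≤ 1 := fun z =>
    max_le ((le_abs_self _).trans (hf' z)) zero_le_one
  have hn1 : ∀ z, max (-f z) 0 ≤ 1 := fun z =>
    max_le ((neg_le_abs _).trans (hf' z)) zero_le_one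
  have hsub := h.gmcDeriv_sub hK γ hp hn
    (fun z => by rw [abs_of_nonneg (hp0 z)]; exact hp1 z)
    (fun z => by rw [abs_of_nonneg (hn0 z)]; exact hn1 z)
  have hff : (fun z => max (f z) 0 - max (-f z) 0) = f := funext fun z => by
    rcases le_total 0 (f z) with hz | hz <;> simp [hz]
  rw [hff] at hsub
  have hDp := h.lintegral_sq_gmcDeriv_le hK γ hg hg0 hCg hp hp0 hp1
  have hDn := h.lintegral_sq_gmcDeriv_le hK γ hg hg0 hCg hn hn0 hn1
  have hmeas : Measurable fun ω => gmcDeriv K γ C (Γ ω) fun z => max (f z) 0 := by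
    simp_rw [gmcDeriv_eq_setIntegral hK.measurableSet]
    exact (h.measurable_gmcDerivIntegrand hK.measurableSet γ
      hp).stronglyMeasurable.integral_prod_right'.measurable
  calc ∫⁻ ω, ENNReal.ofReal (gmcDeriv K γ C (Γ ω) f ^ 2)
      ≤ ∫⁻ ω, (2 * ENNReal.ofReal ((gmcDeriv K γ C (Γ ω) fun z => max (f z) 0) ^ 2)
        + 2 * ENNReal.ofReal ((gmcDeriv K γ C (Γ ω) fun z => max (-f z) 0) ^ 2)) := by
        refine lintegral_mono_ae (hsub.mono fun ω hω => ?_)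
        rw [hω, ← ENNReal.ofReal_ofNat 2, ← ENNReal.ofReal_mul (by norm_num),
          ← ENNReal.ofReal_mul (by norm_num), ← ENNReal.ofReal_add (by positivity) (by positivity)]
        refine ENNReal.ofReal_le_ofReal ?_
        nlinarith [sq_nonneg ((gmcDeriv K γ C (Γ ω) fun z => max (f z) 0)
          + gmcDeriv K γ C (Γ ω) fun z => max (-f z) 0)]
    _ = 2 * (∫⁻ ω, ENNReal.ofReal ((gmcDeriv K γ C (Γ ω) fun z => max (f z) 0) ^ 2))
        + 2 * ∫⁻ ω, ENNReal.ofReal ((gmcDeriv K γ C (Γ ω) fun z => max (-f z) 0) ^ 2) := by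
        rw [lintegral_add_left ((hmeas.pow_const 2).ennreal_ofReal.const_mul 2),
          lintegral_const_mul' _ _ (by simp), lintegral_const_mul' _ _ (by simp)]
    _ ≤ 2 * ENNReal.ofReal A + 2 * ENNReal.ofReal A := by gcongr
    _ = ENNReal.ofReal (4 * A) := by
        rw [← ENNReal.ofReal_ofNat 2, ← ENNReal.ofReal_mul (by norm_num),
          ← ENNReal.ofReal_add (by positivity) (by positivity)]
        congr 1
        ring
    _ ≤ ENNReal.ofReal (4 * A + 1) := ENNReal.ofReal_le_ofReal (by linarith)
end

section
/- Let C₁ > 0, ν₀ > 0, and let p : [0,∞) → [0,1] be a nonincreasing function such that p(ν₀) < 1 and p(ν) ≤ e^{−C₁ ν²} + p(0.8 ν)² for all ν ≥ ν₀. Then there exist constants c > 0 and C > 0 such that p(ν) ≤ c e^{−C ν²} for all ν ≥ 0. -/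
open Filter Topology in
/-- An antitone real sequence with nonnegative terms, starting below `1`, that satisfies
`a (n + 1) ≤ e n + a n ^ 2` with `e` tending to `0`, tends to `0`. -/
theorem tendsto_zero_of_le_add_sq {a e : ℕ → ℝ} (ha : Antitone a) (h0 : ∀ n, 0 ≤ a n)
    (h1 : a 0 < 1) (he : Tendsto e atTop (𝓝 0)) (hrec : ∀ n, a (n + 1) ≤ e n + a n ^ 2) :
    Tendsto a atTop (𝓝 0) := by
  have hbdd : BddBelow (Set.range a) := ⟨0, by rintro _ ⟨n, rfl⟩; exact h0 n⟩
  have hlim := tendsto_atTop_ciInf ha hbdd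
  set L := ⨅ n, a n
  have hL0 : 0 ≤ L := le_ciInf h0
  have hL1 : L < 1 := (ciInf_le hbdd 0).trans_lt h1
  have hL : L ≤ 0 + L ^ 2 :=
    le_of_tendsto_of_tendsto' ((tendsto_add_atTop_iff_nat 1).2 hlim) (he.add (hlim.pow 2)) hrec
  have hL_eq : L = 0 := by nlinarith
  rwa [hL_eq] at hlim

/-- Propagation of a Gaussian bound: if `p ν ≤ exp (-C₁ ν²) + p (0.8 ν)²` for `ν ≥ M`, and
`p ≤ exp (-C ν²) / 2` on `[0.8 M, M]`, then the latter bound holds on `[0.8 M, ∞)`, provided `C` is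
small compared to `C₁` and `M` is large. -/
theorem le_half_exp_of_le_exp_add_sq {C C₁ M : ℝ} {p : ℝ → ℝ} (hC : 0 < C) (hCC₁ : C ≤ C₁ / 2)
    (hM : 0 < M) (hexp : Real.exp (-(C₁ / 2) * M ^ 2) ≤ 1 / 4) (hp : ∀ ν, 0 ≤ ν → 0 ≤ p ν)
    (hrec : ∀ ν, M ≤ ν → p ν ≤ Real.exp (-C₁ * ν ^ 2) + p (0.8 * ν) ^ 2)
    (hbase : ∀ ν, 0.8 * M ≤ ν → ν ≤ M → p ν ≤ 1 / 2 * Real.exp (-C * ν ^ 2)) :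
    ∀ ν, 0.8 * M ≤ ν → p ν ≤ 1 / 2 * Real.exp (-C * ν ^ 2) := by
  have key : ∀ n : ℕ, ∀ ν, 0.8 * M ≤ ν → ν ≤ (5 / 4) ^ n * M →
      p ν ≤ 1 / 2 * Real.exp (-C * ν ^ 2) := by
    intro n
    induction n with
    | zero => simpa using hbase
    | succ n ih =>
      intro ν h1 h2
      rcases le_total ν M with h | h
      · exact hbase ν h1 h
      have hs : p (0.8 * ν) ≤ 1 / 2 * Real.exp (-C * (0.8 * ν) ^ 2) := by
        refine ih _ (by linarith) ?_
        rw [pow_succ] at h2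
        linarith
      have hs2 : p (0.8 * ν) ^ 2 ≤ 1 / 4 * Real.exp (-C * ν ^ 2) := by
        calc p (0.8 * ν) ^ 2 ≤ (1 / 2 * Real.exp (-C * (0.8 * ν) ^ 2)) ^ 2 :=
              pow_le_pow_left₀ (hp _ (by linarith)) hs 2
          _ = 1 / 4 * Real.exp (-(1.28 * (C * ν ^ 2))) := by
              rw [mul_pow, ← Real.exp_nat_mul]
              norm_num
              ring_nf
          _ ≤ 1 / 4 * Real.exp (-C * ν ^ 2) := by
              gcongr
              nlinarith [mul_nonneg hC.le (sq_nonneg ν)]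
      have hMν : M ^ 2 ≤ ν ^ 2 := by gcongr
      have hs1 : Real.exp (-C₁ * ν ^ 2) ≤ 1 / 4 * Real.exp (-C * ν ^ 2) := by
        calc Real.exp (-C₁ * ν ^ 2)
            ≤ Real.exp (-(C₁ / 2) * M ^ 2 + -C * ν ^ 2) := by
              gcongr
              nlinarith [mul_le_mul_of_nonneg_right hCC₁ (sq_nonneg ν)]
          _ ≤ 1 / 4 * Real.exp (-C * ν ^ 2) := by
              rw [Real.exp_add]
              gcongr
      linarith [hrec ν h]
  intro ν hν
  obtain ⟨n, hn⟩ := pow_unbounded_of_one_lt (ν / M) (by norm_num : (1 : ℝ) < 5 / 4)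
  exact key n ν hν ((div_lt_iff₀ hM).1 hn).le

open Filter Topology in
/-- **Bootstrap to a Gaussian tail.** If `p : [0,∞) → [0,1]` is nonincreasing, `p(ν₀) < 1` for
some `ν₀ > 0`, and `p(ν) ≤ e^{−C₁ν²} + p(0.8ν)²` for all `ν ≥ ν₀` (where `C₁ > 0`), then there
are constants `c, C > 0` with `p(ν) ≤ c e^{−Cν²}` for all `ν ≥ 0`. -/
theorem gaussian_tail_bootstrap
    (C₁ ν₀ : ℝ) (hC₁ : 0 < C₁) (hν₀ : 0 < ν₀)
    (p : ℝ → ℝ)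
    (hp01 : ∀ ν : ℝ, 0 ≤ ν → p ν ∈ Set.Icc (0 : ℝ) 1)
    (hmono : AntitoneOn p (Set.Ici (0 : ℝ)))
    (hlt : p ν₀ < 1)
    (hrec : ∀ ν : ℝ, ν₀ ≤ ν → p ν ≤ Real.exp (-C₁ * ν ^ 2) + (p (0.8 * ν)) ^ 2) :
    ∃ c > (0 : ℝ), ∃ C > (0 : ℝ), ∀ ν : ℝ, 0 ≤ ν → p ν ≤ c * Real.exp (-C * ν ^ 2) := by
  set x : ℕ → ℝ := fun n => (5 / 4) ^ n * ν₀ with hx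
  have hx0 : ∀ n, 0 < x n := fun n => by positivity
  have hxs : ∀ n, 0.8 * x (n + 1) = x n := fun n => by simp only [hx, pow_succ]; ring
  have hxmono : Monotone x := fun m n h => by
    simp only [hx]
    gcongr
    norm_num
  have hx_ge : ∀ n, ν₀ ≤ x n := fun n => by simpa [hx] using hxmono (Nat.zero_le n)
  have hxtop : Tendsto (fun n => x (n + 1)) atTop atTop :=
    (tendsto_add_atTop_iff_nat 1).2
      ((tendsto_pow_atTop_atTop_of_one_lt (by norm_num)).atTop_mul_const hν₀)
  have hgauss : ∀ K : ℝ, 0 < K →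
      Tendsto (fun n => Real.exp (-K * x (n + 1) ^ 2)) atTop (𝓝 0) := fun K hK =>
    Real.tendsto_exp_atBot.comp <|
      ((tendsto_pow_atTop two_ne_zero).comp hxtop).const_mul_atTop_of_neg (neg_lt_zero.2 hK)
  have hpx : Tendsto (fun n => p (x n)) atTop (𝓝 0) := by
    refine tendsto_zero_of_le_add_sq (fun m n h => hmono (hx0 m).le (hx0 n).le (hxmono h))
      (fun n => (hp01 _ (hx0 n).le).1) (by simpa [hx] using hlt) (hgauss C₁ hC₁) fun n => ?_
    simpa only [hxs] using hrec (x (n + 1)) (hx_ge _)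
  obtain ⟨n, hpn, hen⟩ := ((hpx.eventually_le_const (by norm_num : (0 : ℝ) < 1 / 4)).and
    ((hgauss (C₁ / 2) (by positivity)).eventually_le_const
      (by norm_num : (0 : ℝ) < 1 / 4))).exists
  set M := x (n + 1)
  have hM : 0 < M := hx0 _
  set C := min (C₁ / 2) (1 / (2 * M ^ 2))
  have hC : 0 < C := lt_min (by positivity) (by positivity)
  have hCM : C * M ^ 2 ≤ 1 / 2 := by
    calc C * M ^ 2 ≤ 1 / (2 * M ^ 2) * M ^ 2 := by gcongr; exact min_le_right _ _
      _ = 1 / 2 := by field_simp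
  have hhalf : ∀ ν, 0 ≤ ν → ν ≤ M → 1 / 2 ≤ Real.exp (-C * ν ^ 2) := fun ν h0 h => by
    have : C * ν ^ 2 ≤ C * M ^ 2 := by gcongr
    linarith [Real.add_one_le_exp (-C * ν ^ 2)]
  have htail := le_half_exp_of_le_exp_add_sq hC (min_le_left _ _) hM hen
    (fun ν h => (hp01 ν h).1) (fun ν h => hrec ν ((hx_ge _).trans h)) fun ν h1 h2 => by
      rw [hxs] at h1
      have h0 : 0 ≤ ν := (hx0 n).le.trans h1
      linarith [hmono (hx0 n).le h0 h1, hhalf ν h0 h2]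
  refine ⟨2, two_pos, C, hC, fun ν h0 => ?_⟩
  rcases le_total ν M with h | h
  · linarith [(hp01 ν h0).2, hhalf ν h0 h]
  · linarith [htail ν (by linarith), Real.exp_pos (-C * ν ^ 2)]
end

section
/- Let (X_i)_{i∈I} be a family of nonnegative integrable random variables on a probability space. Suppose that for every ν > 0 there exist decompositions X_i = A_i + B_i with A_i, B_i ≥ 0 random variables such that sup_{i∈I} E[A_i] ≤ ν and sup_{i∈I} E[B_i²] < ∞ (the latter bound may depend on ν). Then the family (X_i)_{i∈I} is uniformly integrable. -/
open MeasureTheory ProbabilityTheory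

/-- If `x = a + b` with `a, b ≥ 0` and `x ≥ K > 0`, then `x ≤ 2 a + (4 / K) b²`: either `b ≤ a`,
or `b` is at least `K / 2`. -/
lemma add_le_two_mul_add_div_mul_sq {a b K : ℝ} (ha : 0 ≤ a) (hK : 0 < K) (h : K ≤ a + b) :
    a + b ≤ 2 * a + 4 / K * b ^ 2 := by
  rcases le_total b a with hba | hab
  · have : 0 ≤ 4 / K * b ^ 2 := by positivity
    linarith
  · have hb : 2 * b ≤ 4 / K * b ^ 2 := by
      rw [div_mul_eq_mul_div, le_div_iff₀ hK]
      nlinarith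
    linarith

/-- **Uniform integrability from small-`L¹` plus bounded-`L²` decompositions.**
Let `(Xᵢ)` be nonnegative integrable random variables. Suppose for every `ν > 0` there are
decompositions `Xᵢ = Aᵢ + Bᵢ` into nonnegative parts with `E[Aᵢ] ≤ ν` uniformly in `i` and
`sup_i E[Bᵢ²] < ∞`. Then `(Xᵢ)` is uniformly integrable, in the sense that
`sup_i E[Xᵢ 1_{Xᵢ ≥ K}] → 0` as `K → ∞`. -/
theorem uniformly_integrable_of_decomposition
    {Ω : Type*} [MeasureSpace Ω] [IsProbabilityMeasure (ℙ : Measure Ω)]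
    {ι : Type*} (X : ι → Ω → ℝ)
    (hXnn : ∀ i ω, 0 ≤ X i ω)
    (hXint : ∀ i, Integrable (X i) (ℙ : Measure Ω))
    (h : ∀ ν : ℝ, 0 < ν →
      ∃ A B : ι → Ω → ℝ,
        (∀ i ω, X i ω = A i ω + B i ω) ∧
        (∀ i ω, 0 ≤ A i ω) ∧ (∀ i ω, 0 ≤ B i ω) ∧
        (∀ i, Integrable (A i) (ℙ : Measure Ω)) ∧
        (∀ i, Integrable (fun ω => (B i ω) ^ 2) (ℙ : Measure Ω)) ∧
        (∀ i, (∫ ω, A i ω) ≤ ν) ∧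
        (∃ M : ℝ, ∀ i, (∫ ω, (B i ω) ^ 2) ≤ M)) :
    ∀ ε > (0 : ℝ), ∃ K₀ : ℝ, ∀ K : ℝ, K₀ ≤ K → ∀ i,
      (∫ ω in {ω | K ≤ |X i ω|}, |X i ω|) ≤ ε := by
  intro ε hε
  obtain ⟨A, B, hX, hA, -, hAint, hBint, hAle, M, hM⟩ := h (ε / 4) (by positivity)
  refine ⟨max 1 (8 * M / ε), fun K hK i ↦ ?_⟩
  have hK0 : 0 < K := one_pos.trans_le ((le_max_left _ _).trans hK)
  have hMK : 8 * M ≤ K * ε := (div_le_iff₀ hε).1 ((le_max_right _ _).trans hK)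
  have hs : NullMeasurableSet {ω | K ≤ |X i ω|} (ℙ : Measure Ω) :=
    nullMeasurableSet_le aemeasurable_const (hXint i).abs.aemeasurable
  have hint : Integrable (fun ω ↦ 2 * A i ω + 4 / K * B i ω ^ 2) (ℙ : Measure Ω) :=
    ((hAint i).const_mul 2).add ((hBint i).const_mul (4 / K))
  calc ∫ ω in {ω | K ≤ |X i ω|}, |X i ω|
      ≤ ∫ ω in {ω | K ≤ |X i ω|}, (2 * A i ω + 4 / K * B i ω ^ 2) := by
        refine setIntegral_mono_on₀ (hXint i).abs.integrableOn hint.integrableOn hs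
          fun ω hω ↦ ?_
        rw [Set.mem_ofPred_eq, abs_of_nonneg (hXnn i ω), hX i ω] at hω
        rw [abs_of_nonneg (hXnn i ω), hX i ω]
        exact add_le_two_mul_add_div_mul_sq (hA i ω) hK0 hω
    _ ≤ ∫ ω, (2 * A i ω + 4 / K * B i ω ^ 2) :=
        setIntegral_le_integral hint <| .of_forall fun ω ↦
          add_nonneg (mul_nonneg zero_le_two (hA i ω)) (by positivity)
    _ = 2 * (∫ ω, A i ω) + 4 / K * ∫ ω, B i ω ^ 2 := by
        rw [integral_add ((hAint i).const_mul 2) ((hBint i).const_mul (4 / K)),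
          integral_const_mul, integral_const_mul]
    _ ≤ 2 * (ε / 4) + 4 / K * M := by
        gcongr
        exacts [hAle i, hM i]
    _ ≤ ε := by
        have : 4 / K * M ≤ ε / 2 := by
          rw [div_mul_eq_mul_div, div_le_iff₀ hK0]
          linarith
        linarith
end
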